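/- Let 1 < p < ∞, let 0 < ε < 1/2, and let f : 𝕋^∞ → ℝ be a measurable function that is 1-Lipschitz with respect to the metric dist_p. Then there exists a parallel infinite-dimensional subtorus M ⊆ 𝕋^∞ such that the restriction f|_M is measurable and essosc(f; M) ≤ 8ε, where the essential oscillation is taken with respect to the uniform probability measure on M. -/

import Mathlib

noncomputable section
open MeasureTheory ENNReal Filter
open scoped Classical

/-- The infinite-dimensional torus `𝕋^∞ = (ℝ/ℤ)^ℕ`. -/
abbrev InfTorus : Type := ℕ → AddCircle (1 : ℝ)

/-- The product of the uniform probability measures on the circles `ℝ/ℤ`, realized as the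
normalized Haar measure on the compact group `𝕋^∞` (by uniqueness of the translation-invariant
Borel probability measure, they coincide). -/
def torusMeasure : Measure InfTorus :=
  Measure.addHaarMeasure (⊤ : TopologicalSpace.PositiveCompacts InfTorus)

/-- The metric `dist_p` on the infinite torus, valued in `[0,∞]`:
`dist_p(x,y) = (∑ᵢ dist(xᵢ,yᵢ)^p)^(1/p)`. -/
def distP (p : ℝ) (x y : InfTorus) : ℝ≥0∞ := (∑' i, edist (x i) (y i) ^ p) ^ (1 / p)

/-- The map fixing all coordinates outside `A` to the values of `b`. -/
def subtorusProj (A : Set ℕ) (b : InfTorus) (x : InfTorus) : InfTorus :=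
  fun i => if i ∈ A then x i else b i

/-- The uniform probability measure on the parallel subtorus
`M = {x | ∀ i ∉ A, x i = b i}`: the pushforward of the product measure under the projection
onto `M`, i.e. the product of uniform measures over the coordinates in `A`, the remaining
coordinates being fixed to the values of `b`. -/
def subtorusMeasure (A : Set ℕ) (b : InfTorus) : Measure InfTorus :=
  torusMeasure.map (subtorusProj A b)

/-- The essential oscillation `essosc(f;μ) = ess sup f - ess inf f`, expressed equivalently
as the `L^∞(μ × μ)`-norm of `(x,y) ↦ f x - f y`, valued in `[0,∞]`. -/
def essOsc (μ : Measure InfTorus) (f : InfTorus → ℝ) : ℝ≥0∞ :=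
  essSup (fun z : InfTorus × InfTorus => ENNReal.ofReal |f z.1 - f z.2|) (μ.prod μ)

theorem exists_boundedContinuous_measure_le {X : Type*} [TopologicalSpace X] [NormalSpace X]
    [MeasurableSpace X] [BorelSpace X] {μ : Measure X} [IsFiniteMeasure μ] [μ.WeaklyRegular]
    {f : X → ℝ} (hf : AEMeasurable f μ) {η : ℝ} (hη : 0 < η) {δ : ℝ≥0∞} (hδ : δ ≠ 0) :
    ∃ φ : BoundedContinuousFunction X ℝ, μ {x | η ≤ |f x - φ x|} ≤ δ := by
  have hδ2 : δ / 2 ≠ 0 := (ENNReal.half_pos hδ).ne'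
  obtain ⟨K, hK, hKm⟩ := isTightMeasureSet_iff_exists_isCompact_measure_compl_le.1
    (isTightMeasureSet_singleton (μ := μ.map f)) (δ / 2) (ENNReal.half_pos hδ)
  replace hKm := hKm _ rfl
  rw [Measure.map_apply_of_aemeasurable hf hK.measurableSet.compl] at hKm
  obtain ⟨R, hR⟩ := hK.isBounded.exists_norm_le
  have hmem : MemLp (fun x => max (-|R|) (min (f x) |R|)) 1 μ := by
    refine MemLp.of_bound (aemeasurable_const.max (hf.min aemeasurable_const)).aestronglyMeasurable
      |R| (ae_of_all _ fun x => ?_)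
    rw [Real.norm_eq_abs, abs_le]
    exact ⟨le_max_left _ _, max_le (by linarith [abs_nonneg R]) (min_le_right _ _)⟩
  have hη' : ENNReal.ofReal η ≠ 0 := by simpa using hη
  obtain ⟨φ, hφ, hφm⟩ := hmem.exists_boundedContinuous_eLpNorm_sub_le ENNReal.one_ne_top
    (mul_ne_zero hη' hδ2)
  refine ⟨φ, ?_⟩
  have hmarkov := mul_meas_ge_le_pow_eLpNorm' μ one_ne_zero ENNReal.one_ne_top
    (hmem.sub hφm).aestronglyMeasurable (ENNReal.ofReal η)
  simp only [ENNReal.toReal_one, ENNReal.rpow_one] at hmarkov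
  have hmarkov' := (ENNReal.mul_le_mul_iff_right hη' ENNReal.ofReal_ne_top).1 (hmarkov.trans hφ)
  calc μ {x | η ≤ |f x - φ x|}
      ≤ μ (f ⁻¹' Kᶜ ∪ {x | ENNReal.ofReal η ≤
          ‖((fun x => max (-|R|) (min (f x) |R|)) - (φ : X → ℝ)) x‖ₑ}) := by
        refine measure_mono fun x hx => ?_
        by_cases hxK : f x ∈ K
        · right
          have h := (hR _ hxK).trans (le_abs_self R)
          rw [Real.norm_eq_abs, abs_le] at h
          simp only [Set.mem_ofPred_eq, Pi.sub_apply, min_eq_left h.2, max_eq_right h.1]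
          rw [Real.enorm_eq_ofReal_abs]
          exact ENNReal.ofReal_le_ofReal hx
        · exact Or.inl hxK
    _ ≤ δ / 2 + δ / 2 := (measure_union_le _ _).trans (add_le_add hKm hmarkov')
    _ = δ := ENNReal.add_halves δ

theorem eventually_measure_translate_sub_le {G : Type*} [AddGroup G] [TopologicalSpace G]
    [IsTopologicalAddGroup G] [CompactSpace G] [NormalSpace G]
    [MeasurableSpace G] [BorelSpace G] {μ : Measure G} [IsFiniteMeasure μ] [μ.WeaklyRegular]
    [μ.IsAddRightInvariant] {f : G → ℝ} (hf : AEMeasurable f μ) {η : ℝ} (hη : 0 < η)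
    {δ : ℝ≥0∞} (hδ : δ ≠ 0) :
    ∀ᶠ τ in nhds (0 : G), μ {x | η ≤ |f (x + τ) - f x|} ≤ δ := by
  have hη3 : 0 < η / 3 := by positivity
  obtain ⟨φ, hφ⟩ := exists_boundedContinuous_measure_le hf hη3 (ENNReal.half_pos hδ).ne'
  let F : C(G, C(G, ℝ)) := ContinuousMap.curry ⟨fun z => φ (z.2 + z.1), by fun_prop⟩
  have hF : ∀ᶠ τ in nhds (0 : G), dist (F τ) (F 0) < η / 3 :=
    (F.continuous.tendsto 0).eventually (Metric.ball_mem_nhds _ hη3)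
  filter_upwards [hF] with τ hτ
  calc μ {x | η ≤ |f (x + τ) - f x|}
      ≤ μ ((fun x => x + τ) ⁻¹' {x | η / 3 ≤ |f x - φ x|} ∪ {x | η / 3 ≤ |f x - φ x|}) := by
        refine measure_mono fun x hx => ?_
        by_contra hcon
        simp only [Set.mem_union, Set.mem_preimage, Set.mem_ofPred_eq, not_or, not_le] at hcon hx
        have h : |φ (x + τ) - φ x| < η / 3 := by
          have := (ContinuousMap.dist_apply_le_dist x).trans_lt hτ
          simpa [F, Real.dist_eq] using this
        have h1 := abs_lt.1 hcon.1
        have h2 := abs_lt.1 hcon.2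
        have h3 := abs_lt.1 h
        refine hx.not_gt (abs_lt.2 ⟨?_, ?_⟩) <;> linarith
    _ ≤ δ / 2 + δ / 2 := by
        refine (measure_union_le _ _).trans (add_le_add ?_ hφ)
        rwa [measure_preimage_add_right]
    _ = δ := ENNReal.add_halves δ

instance : torusMeasure.IsAddHaarMeasure :=
  inferInstanceAs (Measure.addHaarMeasure _).IsAddHaarMeasure

instance : IsProbabilityMeasure torusMeasure :=
  ⟨Measure.addHaarMeasure_self (K₀ := (⊤ : TopologicalSpace.PositiveCompacts InfTorus))⟩

instance : (torusMeasure.prod torusMeasure).IsAddHaarMeasure :=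
  Measure.prod.instIsAddHaarMeasure _ _

/-- Finitely supported rational vectors, as points of the torus. -/
def ratPoint : (ℕ →₀ ℚ) →+ InfTorus where
  toFun q i := ((q i : ℝ) : AddCircle (1 : ℝ))
  map_zero' := by ext; simp
  map_add' q r := by ext; simp

theorem denseRange_ratPoint : DenseRange ratPoint := by
  intro x
  rw [mem_closure_iff]
  intro U hU hx
  obtain ⟨I, u, hu, hI⟩ := isOpen_pi_iff.1 hU x hx
  have hd : DenseRange (fun q : ℚ => ((q : ℝ) : AddCircle (1 : ℝ))) :=
    (QuotientAddGroup.mk_surjective.denseRange).comp Rat.denseRange_cast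
      (AddCircle.continuous_mk' 1)
  choose! r hr using fun i (hi : i ∈ I) => hd.exists_mem_open (hu i hi).1 ⟨_, (hu i hi).2⟩
  refine ⟨ratPoint (Finsupp.indicator I fun i _ => r i), hI fun i hi => ?_, _, rfl⟩
  have hi' : i ∈ I := hi
  simpa [ratPoint, Finsupp.indicator_apply, hi'] using hr i hi'

theorem ae_exists_add_mem_of_denseRange {G Γ : Type*} [AddCommGroup G] [TopologicalSpace G]
    [IsTopologicalAddGroup G] [SecondCountableTopology G] [MeasurableSpace G] [BorelSpace G]
    {μ : Measure G} [IsFiniteMeasure μ] [μ.InnerRegular] [μ.IsAddLeftInvariant]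
    [AddCommGroup Γ] [Countable Γ] {φ : Γ →+ G} (hφ : DenseRange φ)
    {K : Set G} (hK : NullMeasurableSet K μ) (hpos : μ K ≠ 0) :
    ∀ᵐ x ∂μ, ∃ q, x + φ q ∈ K := by
  have hS : NullMeasurableSet {x | ∃ q, x + φ q ∈ K} μ := by
    rw [Set.ofPred_exists]
    exact NullMeasurableSet.iUnion fun q => hK.preimage
      (measurePreserving_add_right μ (φ q)).quasiMeasurePreserving
  have hdense : Dense {g : G | (g +ᵥ ·) ⁻¹' {x | ∃ q, x + φ q ∈ K} = {x | ∃ q, x + φ q ∈ K}} := by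
    refine hφ.mono ?_
    rintro _ ⟨r, rfl⟩
    ext x
    constructor
    · rintro ⟨q, hq⟩
      refine ⟨r + q, ?_⟩
      rw [map_add, ← add_assoc, add_comm x]
      exact hq
    · rintro ⟨q, hq⟩
      refine ⟨q - r, ?_⟩
      rw [map_sub]
      convert hq using 1
      simp only [vadd_eq_add]
      abel
  have hconst := aeconst_of_dense_setOfPred_preimage_vadd_eq (M := G) hS hdense
  rw [eventuallyConst_set'] at hconst
  rcases hconst with h | h
  · refine absurd (measure_mono_null (fun x hx => ?_) (ae_eq_empty.1 h)) hpos
    exact ⟨0, by simpa using hx⟩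
  · exact Filter.eventuallyEq_univ.1 h

theorem measurePreserving_subtorusProj (A : Set ℕ) :
    MeasurePreserving (fun z : InfTorus × InfTorus => subtorusProj A z.1 z.2)
      (torusMeasure.prod torusMeasure) torusMeasure := by
  let φ : InfTorus × InfTorus →+ InfTorus :=
    { toFun := fun z => subtorusProj A z.1 z.2
      map_zero' := by ext; simp [subtorusProj]
      map_add' := fun z w => by
        ext i
        simp only [subtorusProj, Prod.fst_add, Prod.snd_add, Pi.add_apply]
        split_ifs <;> rfl }
  refine φ.measurePreserving (continuous_pi fun i => ?_) (fun x => ⟨(x, x), ?_⟩) (by simp)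
  · change Continuous fun z : InfTorus × InfTorus => if i ∈ A then z.2 i else z.1 i
    split_ifs <;> fun_prop
  · ext i
    change (if i ∈ A then x i else x i) = x i
    simp

theorem measurable_subtorusProj (A : Set ℕ) (b : InfTorus) : Measurable (subtorusProj A b) := by
  refine measurable_pi_lambda _ fun i => ?_
  change Measurable fun x : InfTorus => if i ∈ A then x i else b i
  split_ifs <;> fun_prop

instance (A : Set ℕ) (b : InfTorus) : IsProbabilityMeasure (subtorusMeasure A b) :=
  Measure.isProbabilityMeasure_map (measurable_subtorusProj A b).aemeasurable

theorem subtorusProj_add (A : Set ℕ) (b x v : InfTorus) :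
    subtorusProj A b (x + v) = subtorusProj A b x + subtorusProj A 0 v := by
  ext i
  simp only [subtorusProj, Pi.add_apply]
  split_ifs <;> simp

theorem ae_aemeasurable_subtorusMeasure {f : InfTorus → ℝ} (hf : AEMeasurable f torusMeasure)
    (A : Set ℕ) : ∀ᵐ b ∂torusMeasure, AEMeasurable f (subtorusMeasure A b) := by
  obtain ⟨g, hg, hfg⟩ := hf
  obtain ⟨E, hEsub, hE, hE0⟩ := exists_measurable_superset_of_null (ae_iff.1 hfg)
  have h0 : ∀ᵐ x ∂torusMeasure, x ∈ Eᶜ := measure_eq_zero_iff_ae_notMem.1 hE0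
  have h1 := (measurePreserving_subtorusProj A).quasiMeasurePreserving.ae h0
  filter_upwards [Measure.ae_ae_of_ae_prod h1] with b hb
  refine ⟨g, hg, ?_⟩
  have h2 : ∀ᵐ x ∂subtorusMeasure A b, x ∈ Eᶜ :=
    (ae_map_iff (measurable_subtorusProj A b).aemeasurable hE.compl).2 hb
  filter_upwards [h2] with x hx
  by_contra h
  exact hx (hEsub h)

theorem exists_subtorusProj_preimage_ne_zero {P : InfTorus → Prop} (hP : ∀ᵐ b ∂torusMeasure, P b)
    {G : Set InfTorus} (hG : MeasurableSet G) (h0 : torusMeasure G ≠ 0) (A : Set ℕ) :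
    ∃ b, P b ∧ torusMeasure (subtorusProj A b ⁻¹' G) ≠ 0 := by
  by_contra! hcon
  have hmp := measurePreserving_subtorusProj A
  rw [← hmp.measure_preimage hG.nullMeasurableSet] at h0
  refine h0 (Measure.measure_prod_null_of_ae_null (hmp.measurable hG) ?_)
  filter_upwards [hP] with b hb using hcon b hb

theorem abs_sub_add_single_le {p : ℝ} (hp : 0 < p) {f : InfTorus → ℝ}
    (hlip : ∀ x y : InfTorus, distP p x y ≠ ∞ → |f x - f y| ≤ (distP p x y).toReal)
    (y : InfTorus) (i : ℕ) (s t : AddCircle (1 : ℝ)) :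
    |f (y + Pi.single i s) - f (y + Pi.single i t)| ≤ dist s t := by
  have h : distP p (y + Pi.single i s) (y + Pi.single i t) = edist s t := by
    unfold distP
    rw [tsum_eq_single i fun j hj => by simp [hj, hp]]
    rw [one_div, ENNReal.rpow_rpow_inv hp.ne']
    simp
  have := hlip _ _ (h.trans_ne (edist_ne_top s t))
  rwa [h, ← dist_edist] at this

theorem tendsto_single_atTop (t : AddCircle (1 : ℝ)) :
    Tendsto (fun m => (Pi.single m t : InfTorus)) atTop (nhds 0) := by
  refine tendsto_pi_nhds.2 fun i => tendsto_const_nhds.congr' ?_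
  filter_upwards [eventually_gt_atTop i] with m hm
  simp [hm.ne]

theorem eventually_measure_single_le {f : InfTorus → ℝ} (hf : AEMeasurable f torusMeasure)
    (t : AddCircle (1 : ℝ)) {η : ℝ} (hη : 0 < η) {δ : ℝ≥0∞} (hδ : δ ≠ 0) :
    ∀ᶠ m in atTop, torusMeasure {x | η ≤ |f (x + Pi.single m t) - f x|} ≤ δ :=
  (tendsto_single_atTop t).eventually (eventually_measure_translate_sub_le hf hη hδ)

theorem exists_coordinate_measure_le {f : InfTorus → ℝ} (hf : AEMeasurable f torusMeasure)
    (P : Finset InfTorus) (D : Finset (AddCircle (1 : ℝ))) (n : ℕ) {η : ℝ} (hη : 0 < η)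
    {δ : ℝ≥0∞} (hδ : δ ≠ 0) :
    ∃ m > n, torusMeasure {x | ∃ u ∈ P, ∃ t ∈ D,
      η ≤ |f (x + u + Pi.single m t) - f (x + u)|} ≤ δ := by
  obtain ⟨δ', hδ', hsum⟩ := ENNReal.exists_pos_sum_of_countable' hδ (P ×ˢ D : Finset _)
  have hev := eventually_all.2 fun z : (P ×ˢ D : Finset _) =>
    eventually_measure_single_le hf z.1.2 hη (hδ' z).ne'
  obtain ⟨m, hm, hmn⟩ := (hev.and (eventually_gt_atTop n)).exists
  refine ⟨m, hmn, ?_⟩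
  let S : (P ×ˢ D : Finset _) → Set InfTorus := fun z =>
    (fun x => x + z.1.1) ⁻¹' {x | η ≤ |f (x + Pi.single m z.1.2) - f x|}
  have hS : ∀ z, torusMeasure (S z) ≤ δ' z := fun z =>
    (measure_preimage_add_right _ _ _).trans_le (hm z)
  have hsub : {x | ∃ u ∈ P, ∃ t ∈ D,
      η ≤ |f (x + u + Pi.single m t) - f (x + u)|} ⊆ ⋃ z, S z := by
    rintro x ⟨u, hu, t, ht, h⟩
    exact Set.mem_iUnion.2 ⟨⟨(u, t), Finset.mem_product.2 ⟨hu, ht⟩⟩, h⟩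
  exact (measure_mono hsub).trans
    ((measure_iUnion_le S).trans ((ENNReal.tsum_le_tsum hS).trans hsum.le))

theorem exists_coordinates_measure_le {f : InfTorus → ℝ} (hf : AEMeasurable f torusMeasure)
    (D : ℕ → Finset (AddCircle (1 : ℝ))) {e : ℕ → ℝ} (he : ∀ k, 0 < e k)
    {δ : ℕ → ℝ≥0∞} (hδ : ∀ k, δ k ≠ 0) :
    ∃ (a : ℕ → ℕ) (P : ℕ → Finset InfTorus), StrictMono a ∧ P 0 = {0} ∧
      (∀ k, ∀ u ∈ P k, ∀ t ∈ D k, u + Pi.single (a k) t ∈ P (k + 1)) ∧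
      ∀ k, torusMeasure {x | ∃ u ∈ P k, ∃ t ∈ D k,
        e k ≤ |f (x + u + Pi.single (a k) t) - f (x + u)|} ≤ δ k := by
  choose next hgt hle using fun k P n => exists_coordinate_measure_le hf P (D k) n (he k) (hδ k)
  let s : ℕ → Finset InfTorus × ℕ := fun k => Nat.rec ({0}, 0) (fun k σ =>
    (Finset.image₂ (fun u t => u + Pi.single (next k σ.1 σ.2) t) σ.1 (D k),
      next k σ.1 σ.2)) k
  refine ⟨fun k => (s (k + 1)).2, fun k => (s k).1, strictMono_nat_of_lt_succ fun k => ?_, rfl,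
    fun k u hu t ht => ?_, fun k => ?_⟩
  · exact hgt (k + 1) (s (k + 1)).1 (s (k + 1)).2
  · exact Finset.mem_image₂_of_mem hu ht
  · exact hle k (s k).1 (s k).2

theorem exists_finset_dist_le {X : Type*} [PseudoMetricSpace X] [CompactSpace X] {r : ℝ}
    (hr : 0 < r) : ∃ D : Finset X, ∀ t, ∃ d ∈ D, dist d t ≤ r := by
  obtain ⟨D, -, hfin, hD⟩ := (isCompact_univ (X := X)).finite_cover_balls hr
  refine ⟨hfin.toFinset, fun t => ?_⟩
  obtain ⟨d, hd, htd⟩ := Set.mem_iUnion₂.1 (hD (Set.mem_univ t))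
  exact ⟨d, hfin.mem_toFinset.2 hd, (Metric.mem_ball'.1 htd).le⟩

theorem exists_coordinates_abs_sub_le {f : InfTorus → ℝ} (hf : AEMeasurable f torusMeasure)
    (hlip : ∀ (y : InfTorus) (i : ℕ) (s t : AddCircle (1 : ℝ)),
      |f (y + Pi.single i s) - f (y + Pi.single i t)| ≤ dist s t)
    {ε : ℝ} (hε : 0 < ε) :
    ∃ (a : ℕ → ℕ) (G : Set InfTorus), StrictMono a ∧ MeasurableSet G ∧ torusMeasure G ≠ 0 ∧
      ∀ x ∈ G, ∀ (k : ℕ) (w : ℕ → AddCircle (1 : ℝ)),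
        |f (x + ∑ j ∈ Finset.range k, Pi.single (a j) (w j)) - f x| ≤ 2 * ε := by
  let e : ℕ → ℝ := fun k => ε / 2 / 2 ^ k
  have he : ∀ k, 0 < e k := fun k => by positivity
  have hsum : ∀ k, ∑ j ∈ Finset.range k, e j ≤ ε := fun k =>
    ((summable_geometric_two' ε).sum_le_tsum _ fun j _ => (he j).le).trans_eq
      (tsum_geometric_two' ε)
  choose D hD using fun k => exists_finset_dist_le (X := AddCircle (1 : ℝ)) (he k)
  obtain ⟨δ, hδ, hδsum⟩ := ENNReal.exists_pos_sum_of_countable' one_ne_zero ℕ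
  obtain ⟨a, P, ha, hP0, hP, hbad⟩ :=
    exists_coordinates_measure_le hf D he fun k => (hδ k).ne'
  set B : ℕ → Set InfTorus := fun k => {x | ∃ u ∈ P k, ∃ t ∈ D k,
        e k ≤ |f (x + u + Pi.single (a k) t) - f (x + u)|}
  have hB : torusMeasure (toMeasurable torusMeasure (⋃ k, B k)) < 1 := by
    rw [measure_toMeasurable]
    exact ((measure_iUnion_le _).trans (ENNReal.tsum_le_tsum hbad)).trans_lt hδsum
  refine ⟨a, (toMeasurable torusMeasure (⋃ k, B k))ᶜ, ha, (measurableSet_toMeasurable _ _).compl,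
    fun h0 => ?_, fun x hx k w => ?_⟩
  · exact hB.ne ((prob_compl_eq_zero_iff (measurableSet_toMeasurable _ _)).1 h0)
  have hxB : ∀ k, x ∉ B k := fun k hk =>
    hx (subset_toMeasurable _ _ (Set.mem_iUnion.2 ⟨k, hk⟩))
  obtain ⟨u, -, hu, hu'⟩ : ∃ u ∈ P k, |f (x + u) - f x| ≤ ∑ j ∈ Finset.range k, e j ∧
      ∀ y, |f (y + u) - f (y + ∑ j ∈ Finset.range k, Pi.single (a j) (w j))| ≤
        ∑ j ∈ Finset.range k, e j := by
    induction k with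
    | zero => exact ⟨0, by simp [hP0], by simp, by simp⟩
    | succ k ih =>
      obtain ⟨u, huP, hu, hu'⟩ := ih
      obtain ⟨d, hdD, hd⟩ := hD k (w k)
      refine ⟨_, hP k u huP d hdD, ?_, fun y => ?_⟩
      · have h := hxB k
        simp only [B, Set.mem_ofPred_eq, not_exists, not_and, not_le] at h
        rw [Finset.sum_range_succ, ← add_assoc]
        have := abs_sub_le (f (x + u + Pi.single (a k) d)) (f (x + u)) (f x)
        linarith [h u huP d hdD]
      · have h1 := hu' (y + Pi.single (a k) d)
        have h2 := hlip (y + ∑ j ∈ Finset.range k, Pi.single (a j) (w j)) (a k) d (w k)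
        rw [add_right_comm] at h1
        rw [add_right_comm, add_right_comm y (∑ j ∈ Finset.range k, _)] at h2
        rw [Finset.sum_range_succ, Finset.sum_range_succ, ← add_assoc, ← add_assoc,
          add_right_comm y (∑ j ∈ Finset.range k, _)]
        exact (abs_sub_le _ _ _).trans (add_le_add h1 (h2.trans hd))
  have := abs_sub_le (f (x + ∑ j ∈ Finset.range k, Pi.single (a j) (w j))) (f (x + u)) (f x)
  have h := hu' x
  rw [abs_sub_comm] at h
  linarith [hsum k]

theorem exists_subtorusProj_ratPoint_eq_sum {a : ℕ → ℕ} (ha : StrictMono a) (q : ℕ →₀ ℚ) :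
    ∃ k, subtorusProj (Set.range a) 0 (ratPoint q) =
      ∑ j ∈ Finset.range k, Pi.single (a j) (ratPoint q (a j)) := by
  refine ⟨q.support.sup id + 1, ?_⟩
  ext i
  rw [Finset.sum_apply]
  by_cases hi : i ∈ Set.range a
  · obtain ⟨j, rfl⟩ := hi
    rw [Finset.sum_eq_single j (fun l _ hl => by simp [ha.injective.ne hl.symm]) fun hj => ?_]
    · simp [subtorusProj]
    · have hq : q (a j) = 0 := by
        by_contra hne
        have h1 : a j ≤ q.support.sup id :=
          Finset.le_sup (f := id) (Finsupp.mem_support_iff.2 hne)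
        have h2 := ha.le_apply (x := j)
        rw [Finset.mem_range] at hj
        omega
      simp [ratPoint, hq]
  · rw [Finset.sum_eq_zero fun j _ => Pi.single_eq_of_ne (fun h => hi ⟨j, h.symm⟩) _]
    simp [subtorusProj, hi]

theorem essOsc_le_of_ae_abs_sub_le {μ : Measure InfTorus} [SFinite μ] {f : InfTorus → ℝ}
    {c r : ℝ} (h : ∀ᵐ x ∂μ, |f x - c| ≤ r) : essOsc μ f ≤ ENNReal.ofReal (2 * r) := by
  refine essSup_le_of_ae_le _ ?_
  filter_upwards [Measure.quasiMeasurePreserving_fst.ae h,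
    Measure.quasiMeasurePreserving_snd.ae h] with z h1 h2
  refine ENNReal.ofReal_le_ofReal ?_
  have := abs_sub_le (f z.1) c (f z.2)
  rw [abs_sub_comm c] at this
  linarith

theorem exists_measure_inter_abs_sub_le_ne_zero {X : Type*} [MeasurableSpace X] {μ : Measure X}
    {K : Set X} (hK : μ K ≠ 0) (h : X → ℝ) {ε : ℝ} (hε : 0 < ε) :
    ∃ c, μ (K ∩ {x | |h x - c| ≤ ε}) ≠ 0 := by
  by_contra! hcon
  refine hK (measure_mono_null (fun x hx => ?_)
    (measure_iUnion_null fun n : ℤ => hcon (n * ε)))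
  refine Set.mem_iUnion.2 ⟨⌊h x / ε⌋, hx, ?_⟩
  have h1 := (le_div_iff₀ hε).1 (Int.floor_le (h x / ε))
  have h2 := (div_lt_iff₀ hε).1 (Int.lt_floor_add_one (h x / ε))
  rw [Set.mem_ofPred_eq, abs_le]
  constructor <;> linarith

theorem ae_map_of_ae_comp {X Y : Type*} [MeasurableSpace X] [MeasurableSpace Y] {μ : Measure X}
    {φ : X → Y} (hφ : Measurable φ) {f : Y → ℝ} (hf : AEMeasurable f (μ.map φ)) {s : Set ℝ}
    (hs : MeasurableSet s) (h : ∀ᵐ x ∂μ, f (φ x) ∈ s) : ∀ᵐ y ∂μ.map φ, f y ∈ s := by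
  obtain ⟨g, hg, hfg⟩ := hf
  have h1 : ∀ᵐ y ∂μ.map φ, g y ∈ s := by
    refine (ae_map_iff hφ.aemeasurable (hg hs)).2 ?_
    filter_upwards [h, ae_of_ae_map hφ.aemeasurable hfg] with x hx hxg
    rwa [← hxg]
  filter_upwards [h1, hfg] with y hy hyg
  rwa [hyg]

theorem ae_exists_add_ratPoint_mem {K : Set InfTorus} (hK : NullMeasurableSet K torusMeasure)
    (hpos : torusMeasure K ≠ 0) : ∀ᵐ x ∂torusMeasure, ∃ q, x + ratPoint q ∈ K :=
  ae_exists_add_mem_of_denseRange denseRange_ratPoint hK hpos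

theorem exists_ae_abs_subtorusProj_sub_le {f : InfTorus → ℝ} {ε : ℝ} (hε : 0 < ε) {a : ℕ → ℕ}
    (ha : StrictMono a) {G : Set InfTorus} (hG : MeasurableSet G)
    (hGf : ∀ x ∈ G, ∀ (k : ℕ) (w : ℕ → AddCircle (1 : ℝ)),
      |f (x + ∑ j ∈ Finset.range k, Pi.single (a j) (w j)) - f x| ≤ 2 * ε)
    {b : InfTorus} (hb : AEMeasurable f (subtorusMeasure (Set.range a) b))
    (hb0 : torusMeasure (subtorusProj (Set.range a) b ⁻¹' G) ≠ 0) :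
    ∃ c, ∀ᵐ x ∂torusMeasure, |f (subtorusProj (Set.range a) b x) - c| ≤ 3 * ε := by
  have hproj := measurable_subtorusProj (Set.range a) b
  have hh : AEMeasurable (fun x => f (subtorusProj (Set.range a) b x)) torusMeasure :=
    hb.comp_measurable hproj
  obtain ⟨c, hc⟩ := exists_measure_inter_abs_sub_le_ne_zero hb0
    (fun x => f (subtorusProj (Set.range a) b x)) hε
  have hc' : NullMeasurableSet {x | |f (subtorusProj (Set.range a) b x) - c| ≤ ε} torusMeasure :=
    nullMeasurableSet_le (hh.sub_const c).abs aemeasurable_const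
  have hK := (hproj hG).nullMeasurableSet.inter hc'
  refine ⟨c, ?_⟩
  filter_upwards [ae_exists_add_ratPoint_mem hK hc] with x hx
  obtain ⟨q, hqG, hqc⟩ := hx
  obtain ⟨k, hk⟩ := exists_subtorusProj_ratPoint_eq_sum ha (-q)
  have h := hGf _ hqG k fun j => ratPoint (-q) (a j)
  rw [← hk, ← subtorusProj_add, map_neg, add_neg_cancel_right] at h
  have := abs_sub_le (f (subtorusProj (Set.range a) b x))
    (f (subtorusProj (Set.range a) b (x + ratPoint q))) c
  rw [Set.mem_ofPred_eq] at hqc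
  linarith

/-- Let `1 < p < ∞`, `0 < ε < 1/2`, and let `f : 𝕋^∞ → ℝ` be measurable
and `1`-Lipschitz w.r.t. `dist_p`. Then there is a parallel infinite-dimensional subtorus
(given by an infinite coordinate set `A` and fixed values `b`) on which `f` is measurable and
has essential oscillation at most `8ε`. -/
theorem exists_subtorus_essOsc_le (p ε : ℝ) (hp : 1 < p) (hε0 : 0 < ε) (hε : ε < 1 / 2)
    (f : InfTorus → ℝ) (hmeas : AEMeasurable f torusMeasure)
    (hlip : ∀ x y : InfTorus, distP p x y ≠ ∞ → |f x - f y| ≤ (distP p x y).toReal) :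
    ∃ (A : Set ℕ) (b : InfTorus), A.Infinite ∧
      AEMeasurable f (subtorusMeasure A b) ∧
      essOsc (subtorusMeasure A b) f ≤ ENNReal.ofReal (8 * ε) := by
  obtain ⟨a, G, ha, hG, hG0, hGf⟩ := exists_coordinates_abs_sub_le hmeas
    (abs_sub_add_single_le (by linarith) hlip) hε0
  obtain ⟨b, hb, hb0⟩ := exists_subtorusProj_preimage_ne_zero
    (ae_aemeasurable_subtorusMeasure hmeas (Set.range a)) hG hG0 (Set.range a)
  refine ⟨Set.range a, b, Set.infinite_range_of_injective ha.injective, hb, ?_⟩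
  obtain ⟨c, hc⟩ := exists_ae_abs_subtorusProj_sub_le hε0 ha hG hGf hb hb0
  have hs : MeasurableSet {y : ℝ | |y - c| ≤ 3 * ε} :=
    measurableSet_le (by fun_prop) measurable_const
  have hM : ∀ᵐ x ∂subtorusMeasure (Set.range a) b, |f x - c| ≤ 3 * ε :=
    ae_map_of_ae_comp (measurable_subtorusProj (Set.range a) b) hb hs hc
  exact (essOsc_le_of_ae_abs_sub_le hM).trans (ENNReal.ofReal_le_ofReal (by linarith))
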